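/- Let K ≥ 2, α ∈ ℝ, and let b : X → ℝ be measurable and integrable. The ‘b(x_j) only’ half estimator, (1/K) Σ_{k=1}^K [ f(x_k) − (1/(K−1)) Σ_{j≠k} ( f(x_j) + α b(x_j) ) ] s(x_k) (with no global correction term), is unbiased: its integral with respect to μ^K equals ∫ f(x) s(x) dμ(x). -/

import Mathlib

open MeasureTheory Finset

section ProductMeasure

variable {ι X E : Type*} [Fintype ι] [MeasurableSpace X] {μ : Measure X} [IsProbabilityMeasure μ]
  [NormedAddCommGroup E] [NormedSpace ℝ E]

/-- Distinct coordinates are independent under a product of probability measures. -/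
lemma indepFun_comp_eval_pi {β γ : Type*} [MeasurableSpace β] [MeasurableSpace γ]
    {g : X → β} {h : X → γ} (hg : Measurable g) (hh : Measurable h) {i j : ι} (hij : i ≠ j) :
    ProbabilityTheory.IndepFun (fun x : ι → X => g (x i)) (fun x => h (x j))
      (Measure.pi fun _ => μ) :=
  ((ProbabilityTheory.iIndepFun_pi (μ := fun _ : ι => μ) (X := fun _ (y : X) => y)
    fun _ => aemeasurable_id).indepFun hij).comp hg hh

lemma integrable_eval_smul_eval_pi [MeasurableSpace E] [BorelSpace E]
    {g : X → ℝ} {h : X → E} (hg : Measurable g) (hh : Measurable h)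
    (hgInt : Integrable g μ) (hhInt : Integrable h μ) {i j : ι} (hij : i ≠ j) :
    Integrable (fun x : ι → X => g (x i) • h (x j)) (Measure.pi fun _ => μ) :=
  (indepFun_comp_eval_pi hg hh hij).integrable_smul
    (integrable_comp_eval (μ := fun _ : ι => μ) hgInt)
    (integrable_comp_eval (μ := fun _ : ι => μ) hhInt)

lemma integral_eval_smul_eval_pi [MeasurableSpace E] [BorelSpace E]
    {g : X → ℝ} {h : X → E} (hg : Measurable g) (hh : Measurable h)
    (hgInt : Integrable g μ) (hhInt : Integrable h μ) {i j : ι} (hij : i ≠ j) :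
    ∫ x : ι → X, g (x i) • h (x j) ∂(Measure.pi fun _ => μ) = (∫ y, g y ∂μ) • ∫ y, h y ∂μ := by
  rw [(indepFun_comp_eval_pi hg hh hij).integral_fun_smul_eq_smul_integral
    (integrable_comp_eval (μ := fun _ : ι => μ) hgInt).aestronglyMeasurable
    (integrable_comp_eval (μ := fun _ : ι => μ) hhInt).aestronglyMeasurable,
    integral_comp_eval (μ := fun _ : ι => μ) hgInt.aestronglyMeasurable,
    integral_comp_eval (μ := fun _ : ι => μ) hhInt.aestronglyMeasurable]

end ProductMeasure

/-- The `b(x_j)` only half double control variate estimator (with no global correction term)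
is unbiased. -/
theorem half_cv_bxj_only_unbiased
    {X : Type*} [MeasurableSpace X] (μ : Measure X) [IsProbabilityMeasure μ]
    (d : ℕ) (s : X → EuclideanSpace ℝ (Fin d)) (f b : X → ℝ)
    (hs : Measurable s) (hf : Measurable f) (hb : Measurable b)
    (hsInt : Integrable s μ) (hfInt : Integrable f μ) (hbInt : Integrable b μ)
    (hfsInt : Integrable (fun x => f x • s x) μ)
    (hs0 : ∫ x, s x ∂μ = 0)
    (K : ℕ) (hK : 2 ≤ K) (α : ℝ) :
    ∫ x, (K : ℝ)⁻¹ •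
        ∑ k, (f (x k)
          - ((K : ℝ) - 1)⁻¹ * ∑ j ∈ univ.erase k, (f (x j) + α * b (x j))) • s (x k)
        ∂(Measure.pi fun _ : Fin K => μ)
      = ∫ y, f y • s y ∂μ := by
  have hg : Measurable fun y => f y + α * b y := hf.add (hb.const_mul α)
  have hgInt : Integrable (fun y => f y + α * b y) μ := hfInt.add (hbInt.const_mul α)
  have hdiag (k : Fin K) :
      Integrable (fun x : Fin K → X => f (x k) • s (x k)) (Measure.pi fun _ => μ) :=
    integrable_comp_eval (μ := fun _ : Fin K => μ) hfsInt
  have hcross (k : Fin K) : ∀ j ∈ univ.erase k,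
      Integrable (fun x : Fin K → X => (f (x j) + α * b (x j)) • s (x k))
        (Measure.pi fun _ => μ) := fun j hj =>
    integrable_eval_smul_eval_pi hg hs hgInt hsInt (ne_of_mem_erase hj)
  have hbaseline (k : Fin K) : Integrable (fun x : Fin K → X =>
      ((K : ℝ) - 1)⁻¹ • ∑ j ∈ univ.erase k, (f (x j) + α * b (x j)) • s (x k))
        (Measure.pi fun _ => μ) :=
    (integrable_finsetSum _ (hcross k)).smul ((K : ℝ) - 1)⁻¹
  have hterm (k : Fin K) : ∫ x : Fin K → X, (f (x k) • s (x k)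
      - ((K : ℝ) - 1)⁻¹ • ∑ j ∈ univ.erase k, (f (x j) + α * b (x j)) • s (x k))
        ∂(Measure.pi fun _ => μ) = ∫ y, f y • s y ∂μ := by
    rw [integral_sub (hdiag k) (hbaseline k), integral_smul, integral_finsetSum _ (hcross k),
      sum_eq_zero fun j hj => by
        rw [integral_eval_smul_eval_pi hg hs hgInt hsInt (ne_of_mem_erase hj), hs0, smul_zero],
      smul_zero, sub_zero]
    exact integral_comp_eval (μ := fun _ : Fin K => μ) hfsInt.aestronglyMeasurable
  have hK0 : (K : ℝ) ≠ 0 := by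
    have : K ≠ 0 := by omega
    exact_mod_cast this
  simp only [sub_smul, mul_smul, sum_smul]
  rw [integral_smul, integral_finsetSum _ fun k _ => by exact (hdiag k).sub (hbaseline k)]
  simp only [hterm, sum_const, card_univ, Fintype.card_fin]
  rw [← Nat.cast_smul_eq_nsmul ℝ, inv_smul_smul₀ hK0]
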